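/- Let 0 < p₀, q₀ < ∞. Then 𝒜(p₀,q₀) = {(p,q) : p ≥ p₀, q ≥ q₀, q/p ≤ q₀/p₀}. That is: a pair (p,q) with 0 < p, q < ∞ belongs to 𝒜(p₀,q₀) if and only if p ≥ p₀, q ≥ q₀ and q/p ≤ q₀/p₀. -/

import Mathlib

open MeasureTheory Set Real Filter
open scoped ENNReal NNReal

/-- The distribution function `λ_f(τ) = |{t > 0 : |f t| > τ}|` of a function on `(0,∞)`
with respect to Lebesgue measure. -/
noncomputable def distribFn (f : ℝ → ℝ) (τ : ℝ) : ℝ≥0∞ :=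
  (volume.restrict (Set.Ioi (0:ℝ))) {t : ℝ | τ < |f t|}

/-- The non-increasing rearrangement `f*(s) = inf{τ > 0 : λ_f(τ) ≤ s}`. -/
noncomputable def rearr (f : ℝ → ℝ) (s : ℝ) : ℝ :=
  sInf {τ : ℝ | 0 < τ ∧ distribFn f τ ≤ ENNReal.ofReal s}

/-- Condition (D): there is `τ₀ ∈ (0,∞)` such that `λ_f(τ) ≤ λ_g(τ)` for `τ < τ₀` and
`λ_f(τ) ≥ λ_g(τ)` for `τ > τ₀`. -/
def CondD (f g : ℝ → ℝ) : Prop :=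
  ∃ τ₀ : ℝ, 0 < τ₀ ∧ (∀ τ : ℝ, 0 < τ → τ < τ₀ → distribFn f τ ≤ distribFn g τ) ∧
    (∀ τ : ℝ, τ₀ < τ → distribFn g τ ≤ distribFn f τ)

/-- Membership in the class `𝒜(p₀,q₀)`: for all measurable `f, g` satisfying condition (D)
and `∫₀^∞ (f*(t)^{q₀} − g*(t)^{q₀}) d(t^{q₀/p₀}) ≥ 0`, the integrability condition
`(f*(t)^q − g*(t)^q) t^{q/p−1} ∈ L¹(0,∞)` implies
`∫₀^∞ (f*(t)^q − g*(t)^q) d(t^{q/p}) ≥ 0`. -/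
def MemA (p₀ q₀ p q : ℝ) : Prop :=
  ∀ f g : ℝ → ℝ, Measurable f → Measurable g → CondD f g →
    IntegrableOn (fun t => (rearr f t ^ q₀ - rearr g t ^ q₀) * t ^ (q₀ / p₀ - 1))
      (Set.Ioi 0) →
    0 ≤ (q₀ / p₀) *
      ∫ t in Set.Ioi (0:ℝ), (rearr f t ^ q₀ - rearr g t ^ q₀) * t ^ (q₀ / p₀ - 1) →
    IntegrableOn (fun t => (rearr f t ^ q - rearr g t ^ q) * t ^ (q / p - 1)) (Set.Ioi 0) →
    0 ≤ (q / p) * ∫ t in Set.Ioi (0:ℝ), (rearr f t ^ q - rearr g t ^ q) * t ^ (q / p - 1)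

section Rearrangement

theorem distribFn_antitone (f : ℝ → ℝ) : Antitone (distribFn f) :=
  fun _ _ h => measure_mono fun _ ht => h.trans_lt ht

theorem rearr_nonneg (f : ℝ → ℝ) (s : ℝ) : 0 ≤ rearr f s :=
  Real.sInf_nonneg fun _ h => h.1.le

theorem rearr_le {f : ℝ → ℝ} {s τ : ℝ} (hτ : 0 < τ) (h : distribFn f τ ≤ ENNReal.ofReal s) :
    rearr f s ≤ τ :=
  csInf_le ⟨0, fun _ h => h.1.le⟩ ⟨hτ, h⟩

theorem distribFn_le_of_rearr_lt {f : ℝ → ℝ} {s τ : ℝ}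
    (hne : ∃ σ, 0 < σ ∧ distribFn f σ ≤ ENNReal.ofReal s) (h : rearr f s < τ) :
    distribFn f τ ≤ ENNReal.ofReal s := by
  obtain ⟨σ, hσ, hlt⟩ := exists_lt_of_csInf_lt hne h
  exact (distribFn_antitone f hlt.le).trans hσ.2

/-- A finite distribution function tends to zero at infinity. -/
theorem exists_distribFn_le {f : ℝ → ℝ} (hf : Measurable f) {τ : ℝ} (h : distribFn f τ ≠ ∞)
    {ε : ℝ≥0∞} (hε : 0 < ε) : ∃ σ, 0 < σ ∧ distribFn f σ ≤ ε := by
  have hanti : Antitone fun n : ℕ => {t : ℝ | (n : ℝ) < |f t|} := by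
    intro m n hmn t (ht : (n : ℝ) < |f t|)
    exact lt_of_le_of_lt (by exact_mod_cast hmn) ht
  obtain ⟨k, hk⟩ := exists_nat_ge τ
  have hlim := tendsto_measure_iInter_atTop (μ := volume.restrict (Ioi (0 : ℝ)))
    (fun n : ℕ => (measurableSet_lt measurable_const
      (by fun_prop : Measurable fun t => |f t|)).nullMeasurableSet) hanti
    ⟨k, ne_top_of_le_ne_top h (distribFn_antitone f hk)⟩
  have hempty : ⋂ n : ℕ, {t : ℝ | (n : ℝ) < |f t|} = ∅ := by
    refine eq_empty_of_forall_notMem fun t ht => ?_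
    obtain ⟨n, hn⟩ := exists_nat_ge |f t|
    exact absurd (mem_iInter.1 ht n) (not_lt.2 hn)
  rw [hempty, measure_empty] at hlim
  obtain ⟨n, hn, hn0⟩ := ((hlim.eventually_lt_const hε).and (eventually_gt_atTop 0)).exists
  exact ⟨n, by exact_mod_cast hn0, hn.le⟩

/-- A function whose distribution function is nowhere finite has rearrangement equal to the
default value `0`. -/
theorem rearr_eq_zero_or_exists {f : ℝ → ℝ} (hf : Measurable f) :
    (∀ s, rearr f s = 0) ∨
      ∀ s, 0 < s → ∃ σ, 0 < σ ∧ distribFn f σ ≤ ENNReal.ofReal s := by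
  by_cases h : ∃ τ, 0 < τ ∧ distribFn f τ ≠ ∞
  · obtain ⟨τ, -, hτ⟩ := h
    exact Or.inr fun s hs => exists_distribFn_le hf hτ (ENNReal.ofReal_pos.2 hs)
  · push Not at h
    left
    intro s
    have : {τ : ℝ | 0 < τ ∧ distribFn f τ ≤ ENNReal.ofReal s} = ∅ := by
      refine eq_empty_of_forall_notMem fun τ hτ => ?_
      have := hτ.2
      rw [h τ hτ.1] at this
      exact ENNReal.ofReal_ne_top (top_le_iff.1 this)
    rw [rearr, this, Real.sInf_empty]

theorem rearr_anti {f : ℝ → ℝ} {s t : ℝ}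
    (hne : ∃ σ, 0 < σ ∧ distribFn f σ ≤ ENNReal.ofReal s) (hst : s ≤ t) :
    rearr f t ≤ rearr f s :=
  le_of_forall_gt_imp_ge_of_dense fun _ hτ => rearr_le ((rearr_nonneg f s).trans_lt hτ)
    ((distribFn_le_of_rearr_lt hne hτ).trans (ENNReal.ofReal_le_ofReal hst))

/-- A nonnegative non-increasing function which is locally constant to the right is its own
rearrangement. -/
theorem rearr_eq_self {f : ℝ → ℝ} (hanti : Antitone f) (hnonneg : ∀ t, 0 ≤ f t)
    (hright : ∀ t, ∃ u, t < u ∧ f t ≤ f u) {t : ℝ} (ht : 0 < t) : rearr f t = f t := by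
  have hmem : ∀ τ, f t ≤ τ → distribFn f τ ≤ ENNReal.ofReal t := by
    intro τ hτ
    have hsub : {s : ℝ | τ < |f s|} ∩ Ioi 0 ⊆ Ioo 0 t := by
      rintro s ⟨hs, hs0⟩
      refine ⟨hs0, lt_of_not_ge fun hts => ?_⟩
      have hs' : τ < |f s| := hs
      rw [abs_of_nonneg (hnonneg s)] at hs'
      linarith [hanti hts]
    rw [distribFn, Measure.restrict_apply' measurableSet_Ioi]
    exact (measure_mono hsub).trans (by simp)
  apply le_antisymm
  · exact le_of_forall_gt_imp_ge_of_dense fun τ hτ =>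
      rearr_le ((hnonneg t).trans_lt hτ) (hmem τ hτ.le)
  · refine le_csInf ⟨f t + 1, by linarith [hnonneg t], hmem _ (by linarith)⟩ ?_
    rintro τ ⟨-, hτ⟩
    by_contra! hlt
    obtain ⟨u, htu, hu⟩ := hright t
    have hsub : Ioo 0 u ⊆ {s : ℝ | τ < |f s|} ∩ Ioi 0 := by
      rintro s ⟨hs0, hsu⟩
      refine ⟨?_, hs0⟩
      change τ < |f s|
      rw [abs_of_nonneg (hnonneg s)]
      linarith [hanti hsu.le]
    rw [distribFn, Measure.restrict_apply' measurableSet_Ioi] at hτ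
    have h := (measure_mono hsub).trans hτ
    rw [Real.volume_Ioo, sub_zero, ENNReal.ofReal_le_ofReal_iff ht.le] at h
    linarith

end Rearrangement

section Sufficiency

theorem rpow_tangent_le {r x y : ℝ} (hr : 1 ≤ r) (hx : 0 ≤ x) (hy : 0 < y) :
    y ^ r + r * y ^ (r - 1) * (x - y) ≤ x ^ r := by
  have h := one_add_mul_self_le_rpow_one_add (s := x / y - 1)
    (by linarith [div_nonneg hx hy.le]) hr
  rw [add_sub_cancel, Real.div_rpow hx hy.le, le_div_iff₀ (by positivity)] at h
  have hpow : y ^ r = y ^ (r - 1) * y := by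
    rw [← Real.rpow_add_one hy.ne', sub_add_cancel]
  calc y ^ r + r * y ^ (r - 1) * (x - y) = (1 + r * (x / y - 1)) * y ^ r := by
        rw [hpow]; field_simp
    _ ≤ x ^ r := h

theorem mul_sub_le_rpow_sub {r c x y : ℝ} (hr : 1 ≤ r) (hc : 0 < c) (hcy : c ≤ y)
    (hyx : y ≤ x) : r * c ^ (r - 1) * (x - y) ≤ x ^ r - y ^ r := by
  have hy := hc.trans_le hcy
  have h := rpow_tangent_le hr (hy.le.trans hyx) hy
  have hpow : c ^ (r - 1) ≤ y ^ (r - 1) := Real.rpow_le_rpow hc.le hcy (by linarith)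
  have : r * c ^ (r - 1) * (x - y) ≤ r * y ^ (r - 1) * (x - y) := by
    have := sub_nonneg.2 hyx
    gcongr
  linarith

theorem rpow_sub_le_mul_sub {r c x y : ℝ} (hr : 1 ≤ r) (hy : 0 ≤ y) (hyx : y ≤ x)
    (hxc : x ≤ c) : x ^ r - y ^ r ≤ r * c ^ (r - 1) * (x - y) := by
  rcases (hy.trans hyx).eq_or_lt with rfl | hx
  · rw [le_antisymm hyx hy]; simp
  have h := rpow_tangent_le hr hy hx
  have hpow : x ^ (r - 1) ≤ c ^ (r - 1) := Real.rpow_le_rpow hx.le hxc (by linarith)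
  have : r * x ^ (r - 1) * (x - y) ≤ r * c ^ (r - 1) * (x - y) := by
    have := sub_nonneg.2 hyx
    gcongr
  linarith

theorem rearr_compare {f g : ℝ → ℝ} {τ₀ s : ℝ} (hτ₀ : 0 < τ₀)
    (hlo : ∀ τ : ℝ, 0 < τ → τ < τ₀ → distribFn f τ ≤ distribFn g τ)
    (hhi : ∀ τ : ℝ, τ₀ < τ → distribFn g τ ≤ distribFn f τ)
    (hne : ∃ σ, 0 < σ ∧ distribFn f σ ≤ ENNReal.ofReal s) :
    (τ₀ < rearr f s ∧ τ₀ ≤ rearr g s ∧ rearr g s ≤ rearr f s) ∨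
      (rearr f s ≤ τ₀ ∧ rearr f s ≤ rearr g s ∧ rearr g s ≤ τ₀) := by
  have hneg : ∃ σ, 0 < σ ∧ distribFn g σ ≤ ENNReal.ofReal s := by
    obtain ⟨σ, hσ, h⟩ := hne
    have hlt : τ₀ < max σ τ₀ + 1 := by linarith [le_max_right σ τ₀]
    refine ⟨_, hτ₀.trans hlt, (hhi _ hlt).trans ((distribFn_antitone f ?_).trans h)⟩
    linarith [le_max_left σ τ₀]
  have hbig : τ₀ < rearr g s → rearr g s ≤ rearr f s := by
    intro h
    by_contra! hlt
    obtain ⟨τ, h1, h2⟩ := exists_between (max_lt h hlt)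
    have hτ : τ₀ < τ := (le_max_left _ _).trans_lt h1
    have := rearr_le (hτ₀.trans hτ) ((hhi τ hτ).trans
      (distribFn_le_of_rearr_lt hne ((le_max_right _ _).trans_lt h1)))
    linarith
  have hsmall : rearr g s < τ₀ → rearr f s ≤ rearr g s := by
    intro h
    by_contra! hlt
    obtain ⟨τ, h1, h2⟩ := exists_between (lt_min h hlt)
    have hτ : 0 < τ := (rearr_nonneg g s).trans_lt h1
    have := rearr_le hτ ((hlo τ hτ (h2.trans_le (min_le_left _ _))).trans
      (distribFn_le_of_rearr_lt hneg h1))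
    linarith [min_le_right τ₀ (rearr f s)]
  rcases lt_or_ge τ₀ (rearr f s) with hf | hf <;>
  rcases lt_trichotomy τ₀ (rearr g s) with hg | hg | hg
  · exact Or.inl ⟨hf, hg.le, hbig hg⟩
  · exact Or.inl ⟨hf, hg.le, by linarith⟩
  · linarith [hsmall hg]
  · linarith [hbig hg]
  · exact Or.inr ⟨hf, by linarith, hg.ge⟩
  · exact Or.inr ⟨hf, hsmall hg, hg.le⟩

/-- If `u ≤ v` and the weighted integral of `u ^ q₀ - v ^ q₀` is nonnegative, then `u = v`
almost everywhere, so every other weighted integral vanishes. -/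
theorem integral_rpow_sub_eq_zero {u v : ℝ → ℝ} {q₀ q b₀ b : ℝ} (hq₀ : 0 < q₀)
    (hu : ∀ t, 0 ≤ u t) (huv : ∀ t, 0 < t → u t ≤ v t)
    (hint : IntegrableOn (fun t => (u t ^ q₀ - v t ^ q₀) * t ^ b₀) (Ioi 0))
    (h : 0 ≤ ∫ t in Ioi (0:ℝ), (u t ^ q₀ - v t ^ q₀) * t ^ b₀) :
    ∫ t in Ioi (0:ℝ), (u t ^ q - v t ^ q) * t ^ b = 0 := by
  have hnonneg : 0 ≤ᵐ[volume.restrict (Ioi (0:ℝ))]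
      fun t => -((u t ^ q₀ - v t ^ q₀) * t ^ b₀) := by
    refine (ae_restrict_iff' measurableSet_Ioi).2 (ae_of_all _ fun t (ht : 0 < t) => ?_)
    have h1 := Real.rpow_le_rpow (hu t) (huv t ht) hq₀.le
    have h2 := (Real.rpow_pos_of_pos ht b₀).le
    change 0 ≤ -((u t ^ q₀ - v t ^ q₀) * t ^ b₀)
    nlinarith
  have hzero : ∫ t in Ioi (0:ℝ), -((u t ^ q₀ - v t ^ q₀) * t ^ b₀) = 0 := by
    refine le_antisymm ?_ (integral_nonneg_of_ae hnonneg)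
    rw [integral_neg]
    linarith
  rw [integral_eq_zero_iff_of_nonneg_ae hnonneg hint.neg] at hzero
  refine integral_eq_zero_of_ae ?_
  filter_upwards [hzero, ae_restrict_mem measurableSet_Ioi] with t hz (ht : 0 < t)
  have hz' : -((u t ^ q₀ - v t ^ q₀) * t ^ b₀) = 0 := hz
  have hw := (Real.rpow_pos_of_pos ht b₀).ne'
  have hpow : u t ^ q₀ = v t ^ q₀ := by
    rcases mul_eq_zero.1 (neg_eq_zero.1 hz') with h | h
    · linarith
    · exact absurd h hw
  have : u t = v t :=
    (Real.rpow_left_inj (hu t) ((hu t).trans (huv t ht)) hq₀.ne').1 hpow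
  simp [this]

theorem weighted_rpow_sub_le {τ₀ s₀ q₀ q b₀ b x y t : ℝ} (hτ₀ : 0 < τ₀) (hs₀ : 0 < s₀)
    (hq₀ : 0 < q₀) (hq : q₀ ≤ q) (hb : b ≤ b₀) (ht : 0 < t) (hx : 0 ≤ x)
    (h : (t ≤ s₀ ∧ τ₀ ≤ y ∧ y ≤ x) ∨ (s₀ ≤ t ∧ x ≤ y ∧ y ≤ τ₀)) :
    q / q₀ * (τ₀ ^ q₀) ^ (q / q₀ - 1) * s₀ ^ (b - b₀) * ((x ^ q₀ - y ^ q₀) * t ^ b₀) ≤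
      (x ^ q - y ^ q) * t ^ b := by
  have hr : 1 ≤ q / q₀ := (one_le_div hq₀).2 hq
  have hpow : ∀ z : ℝ, 0 ≤ z → z ^ q = (z ^ q₀) ^ (q / q₀) := fun z hz => by
    rw [← Real.rpow_mul hz, mul_div_cancel₀ _ hq₀.ne']
  have hy : 0 ≤ y := by
    rcases h with h | h
    · exact hτ₀.le.trans h.2.1
    · exact hx.trans h.2.1
  have htb : t ^ b = t ^ (b - b₀) * t ^ b₀ := by rw [← Real.rpow_add ht, sub_add_cancel]
  have hw : 0 < t ^ b₀ := Real.rpow_pos_of_pos ht b₀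
  have hC : 0 ≤ q / q₀ * (τ₀ ^ q₀) ^ (q / q₀ - 1) := by positivity
  rw [hpow x hx, hpow y hy, htb]
  set C := q / q₀ * (τ₀ ^ q₀) ^ (q / q₀ - 1)
  rcases h with ⟨hts, hτy, hyx⟩ | ⟨hts, hxy, hyτ⟩
  · have h1 : C * (x ^ q₀ - y ^ q₀) ≤ (x ^ q₀) ^ (q / q₀) - (y ^ q₀) ^ (q / q₀) :=
      mul_sub_le_rpow_sub hr (by positivity) (Real.rpow_le_rpow hτ₀.le hτy hq₀.le)
        (Real.rpow_le_rpow hy hyx hq₀.le)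
    have h2 : s₀ ^ (b - b₀) ≤ t ^ (b - b₀) :=
      Real.rpow_le_rpow_of_nonpos ht hts (by linarith)
    have h3 : 0 ≤ x ^ q₀ - y ^ q₀ := sub_nonneg.2 (Real.rpow_le_rpow hy hyx hq₀.le)
    have h4 := mul_le_mul h1 h2 (by positivity) ((mul_nonneg hC h3).trans h1)
    calc _ = C * (x ^ q₀ - y ^ q₀) * s₀ ^ (b - b₀) * t ^ b₀ := by ring
      _ ≤ _ := mul_le_mul_of_nonneg_right h4 hw.le
      _ = _ := by ring
  · have h1 : (y ^ q₀) ^ (q / q₀) - (x ^ q₀) ^ (q / q₀) ≤ C * (y ^ q₀ - x ^ q₀) :=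
      rpow_sub_le_mul_sub hr (by positivity) (Real.rpow_le_rpow hx hxy hq₀.le)
        (Real.rpow_le_rpow hy hyτ hq₀.le)
    have h2 : t ^ (b - b₀) ≤ s₀ ^ (b - b₀) :=
      Real.rpow_le_rpow_of_nonpos hs₀ hts (by linarith)
    have h3 : 0 ≤ y ^ q₀ - x ^ q₀ := sub_nonneg.2 (Real.rpow_le_rpow hx hxy hq₀.le)
    have h4 := mul_le_mul h1 h2 (by positivity) (mul_nonneg hC h3)
    have h5 := mul_le_mul_of_nonneg_right h4 hw.le
    linarith

theorem memA_of_le {p₀ q₀ p q : ℝ} (hq₀ : 0 < q₀) (hp : 0 < p) (hp₀ : 0 < p₀)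
    (hq : q₀ ≤ q) (hb : q / p ≤ q₀ / p₀) : MemA p₀ q₀ p q := by
  rintro f g hf - ⟨τ₀, hτ₀, hlo, hhi⟩ hint₀ h₀ hint
  have hq' : 0 < q := hq₀.trans_le hq
  replace h₀ := nonneg_of_mul_nonneg_right h₀ (by positivity)
  refine mul_nonneg (by positivity) ?_
  have hle : (∀ t, 0 < t → rearr f t ≤ rearr g t) →
      0 ≤ ∫ t in Ioi (0:ℝ), (rearr f t ^ q - rearr g t ^ q) * t ^ (q / p - 1) := fun h =>
    (integral_rpow_sub_eq_zero hq₀ (rearr_nonneg f) h hint₀ h₀).ge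
  rcases rearr_eq_zero_or_exists hf with hz | hne
  · exact hle fun t _ => by rw [hz]; exact rearr_nonneg g t
  have hcmp := fun t (ht : 0 < t) => rearr_compare hτ₀ hlo hhi (hne t ht)
  by_cases hA : ∃ t, 0 < t ∧ τ₀ < rearr f t
  swap
  · push Not at hA
    refine hle fun t ht => ?_
    rcases hcmp t ht with h | h
    · linarith [hA t ht, h.1]
    · exact h.2.1
  by_cases hB : ∃ t, 0 < t ∧ rearr f t ≤ τ₀
  swap
  · push Not at hB
    refine setIntegral_nonneg measurableSet_Ioi fun t (ht : 0 < t) => ?_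
    rcases hcmp t ht with h | h
    · exact mul_nonneg (sub_nonneg.2 (Real.rpow_le_rpow (rearr_nonneg g t) h.2.2 hq'.le))
        (by positivity)
    · linarith [hB t ht, h.1]
  obtain ⟨s₀, hsA, hsB⟩ := exists_between_of_forall_le
    (s := {t | 0 < t ∧ τ₀ < rearr f t}) (t := {t | 0 < t ∧ rearr f t ≤ τ₀}) hA hB (by
      rintro a ⟨ha, hfa⟩ b ⟨hb, hfb⟩
      by_contra! hba
      linarith [rearr_anti (hne b hb) hba.le])
  have hs₀ : 0 < s₀ := by
    obtain ⟨t, ht⟩ := hA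
    exact ht.1.trans_le (hsA ht)
  have hmono := setIntegral_mono_on
    (hint₀.const_mul (q / q₀ * (τ₀ ^ q₀) ^ (q / q₀ - 1) * s₀ ^ (q / p - 1 - (q₀ / p₀ - 1))))
    hint measurableSet_Ioi fun t (ht : 0 < t) =>
      weighted_rpow_sub_le hτ₀ hs₀ hq₀ hq (by linarith) ht (rearr_nonneg f t) (by
        rcases hcmp t ht with h | h
        · exact Or.inl ⟨hsA ⟨ht, h.1⟩, h.2⟩
        · exact Or.inr ⟨hsB ⟨ht, h.1⟩, h.2⟩)
  rw [integral_const_mul] at hmono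
  exact (mul_nonneg (by positivity) h₀).trans hmono

end Sufficiency

section Necessity

/-- The step function equal to `A` left of `S`, to `B` on `[S, T)` and to `0` from `T` on. -/
noncomputable def twoStep (A B S T t : ℝ) : ℝ :=
  if t < S then A else if t < T then B else 0

variable {A B S T : ℝ}

theorem measurable_twoStep : Measurable (twoStep A B S T) :=
  Measurable.ite measurableSet_Iio measurable_const
    (Measurable.ite measurableSet_Iio measurable_const measurable_const)

theorem twoStep_nonneg (hB : 0 ≤ B) (hBA : B ≤ A) (t : ℝ) : 0 ≤ twoStep A B S T t := by
  unfold twoStep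
  split_ifs <;> linarith

theorem antitone_twoStep (hB : 0 ≤ B) (hBA : B ≤ A) :
    Antitone (twoStep A B S T) := by
  intro s t hst
  unfold twoStep
  split_ifs <;> linarith

theorem rearr_twoStep (hB : 0 ≤ B) (hBA : B ≤ A) {t : ℝ} (ht : 0 < t) :
    rearr (twoStep A B S T) t = twoStep A B S T t := by
  refine rearr_eq_self (antitone_twoStep hB hBA) (twoStep_nonneg hB hBA) (fun t => ?_) ht
  rcases lt_or_ge t S with h | h
  · obtain ⟨u, h1, h2⟩ := exists_between h
    exact ⟨u, h1, by simp [twoStep, h, h2]⟩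
  · rcases lt_or_ge t T with h' | h'
    · obtain ⟨u, h1, h2⟩ := exists_between h'
      exact ⟨u, h1, by simp [twoStep, h.not_gt, h', h2, (h.trans h1.le).not_gt]⟩
    · refine ⟨t + 1, by linarith, ?_⟩
      have h1 : ¬ t + 1 < S := by linarith
      have h2 : ¬ t + 1 < T := by linarith
      simp [twoStep, h.not_gt, h'.not_gt, h1, h2]

theorem hasIntegral_Iio_rpow {b u c : ℝ} (hb : 0 < b) (hu : 0 ≤ u) :
    IntegrableOn (fun t => (Iio u).indicator (fun t => c * t ^ (b - 1)) t) (Ioi 0) ∧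
      ∫ t in Ioi (0:ℝ), (Iio u).indicator (fun t => c * t ^ (b - 1)) t = c * (u ^ b / b) := by
  have hint : IntegrableOn (fun t : ℝ => c * t ^ (b - 1)) (Ioo 0 u) :=
    ((intervalIntegral.intervalIntegrable_rpow' (a := 0) (b := u) (by linarith)).1.mono_set
      Ioo_subset_Ioc_self).const_mul c
  refine ⟨?_, ?_⟩
  · rw [integrableOn_indicator_iff measurableSet_Iio, inter_comm, Ioi_inter_Iio]
    exact hint
  · rw [setIntegral_indicator measurableSet_Iio, Ioi_inter_Iio, integral_const_mul,
      ← integral_Ioc_eq_integral_Ioo, ← intervalIntegral.integral_of_le hu,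
      integral_rpow (Or.inl (by linarith)), sub_add_cancel, Real.zero_rpow hb.ne', sub_zero]

theorem twoStep_rpow_integral {q b : ℝ} (hq : 0 < q) (hb : 0 < b) (hS : 0 ≤ S) (hST : S ≤ T) :
    IntegrableOn (fun t => twoStep A B S T t ^ q * t ^ (b - 1)) (Ioi 0) ∧
      ∫ t in Ioi (0:ℝ), twoStep A B S T t ^ q * t ^ (b - 1) =
        ((A ^ q - B ^ q) * S ^ b + B ^ q * T ^ b) / b := by
  have heq : (fun t => twoStep A B S T t ^ q * t ^ (b - 1)) = fun t =>
      (Iio S).indicator (fun t => (A ^ q - B ^ q) * t ^ (b - 1)) t +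
        (Iio T).indicator (fun t => B ^ q * t ^ (b - 1)) t := by
    funext t
    by_cases h1 : t < S
    · have h2 : t < T := h1.trans_le hST
      simp [twoStep, h1, h2]
      ring
    · by_cases h2 : t < T <;> simp [twoStep, h1, h2, hq.ne']
  obtain ⟨i1, e1⟩ := hasIntegral_Iio_rpow (c := A ^ q - B ^ q) hb hS
  obtain ⟨i2, e2⟩ := hasIntegral_Iio_rpow (c := B ^ q) hb (hS.trans hST)
  rw [heq]
  refine ⟨i1.add i2, ?_⟩
  rw [integral_add i1 i2, e1, e2]
  ring

theorem rearr_twoStep_sub_integral {A' B' S' T' q b : ℝ} (hq : 0 < q) (hb : 0 < b)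
    (hB : 0 ≤ B) (hBA : B ≤ A) (hS : 0 ≤ S) (hST : S ≤ T)
    (hB' : 0 ≤ B') (hBA' : B' ≤ A') (hS' : 0 ≤ S') (hST' : S' ≤ T') :
    IntegrableOn (fun t => (rearr (twoStep A B S T) t ^ q - rearr (twoStep A' B' S' T') t ^ q) *
        t ^ (b - 1)) (Ioi 0) ∧
      b * ∫ t in Ioi (0:ℝ), (rearr (twoStep A B S T) t ^ q -
          rearr (twoStep A' B' S' T') t ^ q) * t ^ (b - 1) =
        ((A ^ q - B ^ q) * S ^ b + B ^ q * T ^ b) -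
          ((A' ^ q - B' ^ q) * S' ^ b + B' ^ q * T' ^ b) := by
  obtain ⟨i1, e1⟩ := twoStep_rpow_integral (A := A) (B := B) hq hb hS hST
  obtain ⟨i2, e2⟩ := twoStep_rpow_integral (A := A') (B := B') hq hb hS' hST'
  have heq : EqOn (fun t => twoStep A B S T t ^ q * t ^ (b - 1) -
      twoStep A' B' S' T' t ^ q * t ^ (b - 1))
      (fun t => (rearr (twoStep A B S T) t ^ q - rearr (twoStep A' B' S' T') t ^ q) *
        t ^ (b - 1)) (Ioi 0) := fun t ht => by
    simp only [rearr_twoStep hB hBA ht, rearr_twoStep hB' hBA' ht, sub_mul]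
  refine ⟨IntegrableOn.congr_fun (i1.sub i2) heq measurableSet_Ioi, ?_⟩
  rw [← setIntegral_congr_fun measurableSet_Ioi heq, integral_sub i1 i2, e1, e2]
  field_simp

theorem MemA.twoStep_le {p₀ q₀ p q A' B' S' T' : ℝ} (h : MemA p₀ q₀ p q)
    (hp₀ : 0 < p₀) (hq₀ : 0 < q₀) (hp : 0 < p) (hq : 0 < q)
    (hB : 0 ≤ B) (hBA : B ≤ A) (hS : 0 ≤ S) (hST : S ≤ T)
    (hB' : 0 ≤ B') (hBA' : B' ≤ A') (hS' : 0 ≤ S') (hST' : S' ≤ T')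
    (hD : CondD (twoStep A B S T) (twoStep A' B' S' T'))
    (h₀ : (A' ^ q₀ - B' ^ q₀) * S' ^ (q₀ / p₀) + B' ^ q₀ * T' ^ (q₀ / p₀) ≤
      (A ^ q₀ - B ^ q₀) * S ^ (q₀ / p₀) + B ^ q₀ * T ^ (q₀ / p₀)) :
    (A' ^ q - B' ^ q) * S' ^ (q / p) + B' ^ q * T' ^ (q / p) ≤
      (A ^ q - B ^ q) * S ^ (q / p) + B ^ q * T ^ (q / p) := by
  obtain ⟨i₀, e₀⟩ := rearr_twoStep_sub_integral hq₀ (div_pos hq₀ hp₀) hB hBA hS hST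
    hB' hBA' hS' hST'
  obtain ⟨i, e⟩ := rearr_twoStep_sub_integral hq (div_pos hq hp) hB hBA hS hST
    hB' hBA' hS' hST'
  have := h _ _ measurable_twoStep measurable_twoStep hD i₀ (by rw [e₀]; linarith) i
  rw [e] at this
  linarith

theorem CondD.of_abs {f g : ℝ → ℝ} {τ₀ : ℝ} (hτ₀ : 0 < τ₀)
    (hlo : ∀ τ t, 0 < τ → τ < τ₀ → τ < |f t| → τ < |g t|)
    (hhi : ∀ τ t, τ₀ < τ → τ < |g t| → τ < |f t|) : CondD f g :=
  ⟨τ₀, hτ₀, fun τ h1 h2 => measure_mono fun t => hlo τ t h1 h2,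
    fun τ h1 => measure_mono fun t => hhi τ t h1⟩

theorem eventually_pos_of_hasDerivAt {F : ℝ → ℝ} {c : ℝ} (hF : HasDerivAt F c 0)
    (h0 : F 0 = 0) (hc : 0 < c) : ∀ᶠ h in nhdsWithin 0 (Ioi 0), 0 < F h := by
  have h := (hasDerivAt_iff_tendsto_slope.1 hF).eventually_const_lt hc
  have h' := h.filter_mono (nhdsWithin_mono (0 : ℝ) fun x (hx : 0 < x) => hx.ne')
  filter_upwards [h', self_mem_nhdsWithin] with x hx (hx0 : 0 < x)
  rw [slope_def_field, h0, sub_zero, sub_zero] at hx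
  exact (div_pos_iff_of_pos_right hx0).1 hx

theorem hasDerivAt_one_add_mul_rpow (c r : ℝ) :
    HasDerivAt (fun h : ℝ => (1 + c * h) ^ r) (r * c) 0 := by
  have h1 : HasDerivAt (fun h : ℝ => 1 + c * h) c 0 := by
    simpa using ((hasDerivAt_id (0:ℝ)).const_mul c).const_add 1
  convert h1.rpow_const (p := r) (by simp) using 1
  simp
  ring

theorem MemA.div_le {p₀ q₀ p q : ℝ} (h : MemA p₀ q₀ p q)
    (hp₀ : 0 < p₀) (hq₀ : 0 < q₀) (hp : 0 < p) (hq : 0 < q) : q / p ≤ q₀ / p₀ := by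
  by_contra! hlt
  set s : ℝ := 1 / 2
  have hs : (0:ℝ) < s := by norm_num [s]
  have hs1 : s < 1 := by norm_num [s]
  have hr : 0 < q / q₀ := by positivity
  have hpow : s ^ (q / p) < s ^ (q₀ / p₀) := Real.rpow_lt_rpow_of_exponent_gt hs hs1 hlt
  have hs0 : 0 < s ^ (q₀ / p₀) := by positivity
  have hsle : s ^ (q₀ / p₀) < 1 := Real.rpow_lt_one hs.le hs1 (by positivity)
  have hd := ((hasDerivAt_one_add_mul_rpow (s ^ (q₀ / p₀)) (q / q₀)).sub_const 1).sub
    (((hasDerivAt_one_add_mul_rpow 1 (q / q₀)).sub_const 1).mul_const (s ^ (q / p)))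
  obtain ⟨η, hη, hη0 : 0 < η⟩ := ((eventually_pos_of_hasDerivAt hd (by simp) (by
    nlinarith)).and self_mem_nhdsWithin).exists
  have hη' : ((1 + η) ^ (q / q₀) - 1) * s ^ (q / p) <
      (1 + s ^ (q₀ / p₀) * η) ^ (q / q₀) - 1 := by
    simpa using hη
  set d := s ^ (q₀ / p₀)
  have hdη : 0 < d * η := by positivity
  set a := (1 + η) ^ (1 / q₀) with ha
  set b := (1 + d * η) ^ (1 / q₀) with hb
  have ha₀ : a ^ q₀ = 1 + η := by
    rw [ha, ← Real.rpow_mul (by positivity), one_div_mul_cancel hq₀.ne', Real.rpow_one]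
  have hb₀ : b ^ q₀ = 1 + d * η := by
    rw [hb, ← Real.rpow_mul (by positivity), one_div_mul_cancel hq₀.ne', Real.rpow_one]
  have haq : a ^ q = (1 + η) ^ (q / q₀) := by
    rw [ha, ← Real.rpow_mul (by positivity), one_div_mul_eq_div]
  have hbq : b ^ q = (1 + d * η) ^ (q / q₀) := by
    rw [hb, ← Real.rpow_mul (by positivity), one_div_mul_eq_div]
  have hb1 : 1 ≤ b := Real.one_le_rpow (by linarith) (by positivity)
  have hba : b ≤ a := Real.rpow_le_rpow (by positivity) (by nlinarith) (by positivity)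
  have hfin := h.twoStep_le (A := a) (B := 1) (S := s) (T := 1) (A' := b) (B' := b)
    (S' := s) (T' := 1) hp₀ hq₀ hp hq zero_le_one (hb1.trans hba) hs.le hs1.le
    (zero_le_one.trans hb1) le_rfl hs.le hs1.le
    (by
      refine CondD.of_abs (τ₀ := b) (by linarith) ?_ ?_
      · intro τ t hτ hτb
        rw [abs_of_nonneg (twoStep_nonneg zero_le_one (hb1.trans hba) t),
          abs_of_nonneg (twoStep_nonneg (zero_le_one.trans hb1) le_rfl t)]
        unfold twoStep
        split_ifs <;> intros <;> linarith
      · intro τ t hτ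
        rw [abs_of_nonneg (twoStep_nonneg (zero_le_one.trans hb1) le_rfl t)]
        unfold twoStep
        split_ifs <;> intros <;> linarith)
    (by simp only [ha₀, hb₀, Real.one_rpow]; apply le_of_eq; ring)
  simp only [haq, hbq, Real.one_rpow] at hfin
  linarith

theorem MemA.le_snd {p₀ q₀ p q : ℝ} (h : MemA p₀ q₀ p q)
    (hp₀ : 0 < p₀) (hq₀ : 0 < q₀) (hp : 0 < p) (hq : 0 < q) : q₀ ≤ q := by
  by_contra! hlt
  have hr1 : 1 < q₀ / q := (one_lt_div hq).2 hlt
  have hr2 : (2:ℝ) < 2 ^ (q₀ / q) := by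
    simpa using Real.rpow_lt_rpow_of_exponent_lt one_lt_two hr1
  obtain ⟨M, hM2, hMlt⟩ := exists_between hr2
  have hM0 : 0 < M := by linarith
  have hMr : M ^ (q / q₀) < 2 := by
    have := Real.rpow_lt_rpow hM0.le hMlt (div_pos hq hq₀)
    rwa [← Real.rpow_mul zero_le_two, div_mul_div_cancel₀ hq.ne', div_self hq₀.ne',
      Real.rpow_one] at this
  have hβ₀ := div_pos hq₀ hp₀
  have hβ := div_pos hq hp
  have hd₀ := (((hasDerivAt_one_add_mul_rpow (-1) (q₀ / p₀)).const_sub 1).const_mul M).sub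
    ((hasDerivAt_one_add_mul_rpow 1 (q₀ / p₀)).sub (hasDerivAt_one_add_mul_rpow (-1) (q₀ / p₀)))
  have hd := ((hasDerivAt_one_add_mul_rpow 1 (q / p)).sub
    (hasDerivAt_one_add_mul_rpow (-1) (q / p))).sub
    (((hasDerivAt_one_add_mul_rpow (-1) (q / p)).const_sub 1).const_mul (M ^ (q / q₀)))
  obtain ⟨ε, hε₀, hε, hεpos, hε1⟩ :=
    ((eventually_pos_of_hasDerivAt hd₀ (by simp) (by nlinarith)).and
      ((eventually_pos_of_hasDerivAt hd (by simp) (by nlinarith)).and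
        (Ioo_mem_nhdsGT (zero_lt_one (α := ℝ))))).exists
  have e1 : (1:ℝ) + 1 * ε = 1 + ε := by ring
  have e2 : (1:ℝ) + -1 * ε = 1 - ε := by ring
  simp only [Pi.sub_apply, e1, e2] at hε₀ hε
  set a := M ^ (1 / q₀) with ha
  have ha₀ : a ^ q₀ = M := by
    rw [ha, ← Real.rpow_mul hM0.le, one_div_mul_cancel hq₀.ne', Real.rpow_one]
  have haq : a ^ q = M ^ (q / q₀) := by
    rw [ha, ← Real.rpow_mul hM0.le, one_div_mul_eq_div]
  have ha1 : 1 ≤ a := Real.one_le_rpow (by linarith) (by positivity)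
  have ha0 : 0 ≤ a := zero_le_one.trans ha1
  have hfin := h.twoStep_le (A := a) (B := a) (S := 1 - ε) (T := 1) (A' := a) (B' := 1)
    (S' := 1 - ε) (T' := 1 + ε) hp₀ hq₀ hp hq ha0 le_rfl (by linarith) (by linarith)
    zero_le_one ha1 (by linarith) (by linarith)
    (by
      refine CondD.of_abs (τ₀ := 1) one_pos ?_ ?_
      · intro τ t hτ hτb
        rw [abs_of_nonneg (twoStep_nonneg ha0 le_rfl t),
          abs_of_nonneg (twoStep_nonneg zero_le_one ha1 t)]
        unfold twoStep
        split_ifs <;> intros <;> linarith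
      · intro τ t hτ
        rw [abs_of_nonneg (twoStep_nonneg ha0 le_rfl t),
          abs_of_nonneg (twoStep_nonneg zero_le_one ha1 t)]
        unfold twoStep
        split_ifs <;> intros <;> linarith)
    (by simp only [ha₀, Real.one_rpow]; linarith)
  simp only [haq, Real.one_rpow] at hfin
  linarith

end Necessity

/-- Characterization of the set `𝒜(p₀,q₀)`:
`𝒜(p₀,q₀) = {(p,q) : p ≥ p₀, q ≥ q₀, q/p ≤ q₀/p₀}`. -/
theorem statement5 (p₀ q₀ : ℝ) (hp₀ : 0 < p₀) (hq₀ : 0 < q₀) (p q : ℝ)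
    (hp : 0 < p) (hq : 0 < q) :
    MemA p₀ q₀ p q ↔ (p₀ ≤ p ∧ q₀ ≤ q ∧ q / p ≤ q₀ / p₀) := by
  refine ⟨fun h => ?_, fun h => memA_of_le hq₀ hp hp₀ h.2.1 h.2.2⟩
  have hq' := h.le_snd hp₀ hq₀ hp hq
  have hb := h.div_le hp₀ hq₀ hp hq
  refine ⟨?_, hq', hb⟩
  rw [div_le_div_iff₀ hp hp₀] at hb
  by_contra! hlt
  nlinarith
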